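/- arXiv:2211.06858 — 9 statements merged into one kernel-verified Lean document; each statement's English description precedes it below -/
import Mathlib

section
/- Let G be a finite simple graph with maximum degree at most Δ, where Δ ≥ 1, let v be a vertex of G, and let r ≥ 1 be an integer. Then the number of vertex subsets T with |T| = r, v ∈ T, and G[T] connected is at most 2^{2r} · Δ^{r−1}. -/
def ExpT {V : Type*} (G : SimpleGraph V) (A X T : Finset V) : Prop :=
  A ⊆ T ∧ (∀ x ∈ T, x ∉ X) ∧
    ∀ S : Finset V, A ⊆ S → S ⊆ T → S ≠ T → ∃ a ∈ S, ∃ t ∈ T, t ∉ S ∧ G.Adj a t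

open Classical in
theorem count_aux {V : Type*} [Fintype V] (G : SimpleGraph V) (Δ : ℕ)
    (hdeg : ∀ u : V, (G.neighborFinset u).card ≤ Δ) (k : ℕ) :
    ∀ (m : ℕ) (A X F : Finset V), F.card ≤ m →
      (∀ a ∈ A, ∀ b, G.Adj a b → b ∈ A ∨ b ∈ X ∨ b ∈ F) →
      (Finset.univ.filter (fun T : Finset V => T.card = A.card + k ∧ ExpT G A X T)).card
        ≤ (m + k * Δ).choose k := by
  induction k with
  | zero =>
    intro m A X F _ _
    simp only [Nat.choose_zero_right]
    refine Finset.card_le_one.2 ?_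
    intro T hT T' hT'
    simp only [Finset.mem_filter, Finset.mem_univ, true_and] at hT hT'
    rw [← Finset.eq_of_subset_of_card_le hT.2.1 (by omega),
      ← Finset.eq_of_subset_of_card_le hT'.2.1 (by omega)]
  | succ k ihk =>
    intro m
    induction m with
    | zero =>
      intro A X F hF hN
      have hF0 : F = ∅ := Finset.card_eq_zero.1 (by omega)
      subst hF0
      rw [Finset.filter_eq_empty_iff.2]
      · simp
      · rintro T - ⟨hc, hA, hX, hE⟩
        obtain ⟨a, ha, t, ht, htA, hadj⟩ := hE A subset_rfl hA (by rintro rfl; omega)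
        rcases hN a ha t hadj with h | h | h
        · exact htA h
        · exact hX t ht h
        · simp at h
    | succ m ihm =>
      intro A X F hF hN
      have hmono : (m + (k+1) * Δ).choose (k+1) ≤ (m + 1 + (k+1) * Δ).choose (k+1) :=
        Nat.choose_le_choose _ (by omega)
      by_cases hFe : F.card ≤ m
      · exact (ihm A X F hFe hN).trans hmono
      obtain ⟨w, hw⟩ : F.Nonempty := Finset.card_pos.1 (by omega)
      have hce : (F.erase w).card ≤ m := by rw [Finset.card_erase_of_mem hw]; omega
      by_cases hwA : w ∈ A
      · refine (ihm A X (F.erase w) hce ?_).trans hmono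
        intro a ha b hab
        have := hN a ha b hab
        by_cases hb : b = w
        · subst hb; exact Or.inl hwA
        · simpa [hb] using this
      · have h1 := ihm A (insert w X) (F.erase w) hce (by
          intro a ha b hab
          have := hN a ha b hab
          by_cases hb : b = w
          · simp [hb]
          · simpa [hb] using this)
        have h2 := ihk (m + Δ) (insert w A) X (F.erase w ∪ G.neighborFinset w)
          ((Finset.card_union_le _ _).trans (add_le_add hce (hdeg w))) (by
          intro a ha b hab
          by_cases hb : b = w
          · simp [hb]
          · rcases Finset.mem_insert.1 ha with rfl | ha
            · simp [hab]
            · have := hN a ha b hab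
              simp only [Finset.mem_insert, Finset.mem_union, Finset.mem_erase]
              tauto)
        have hsub : (Finset.univ.filter
            (fun T : Finset V => T.card = A.card + (k+1) ∧ ExpT G A X T)) ⊆
            (Finset.univ.filter
              (fun T : Finset V => T.card = (insert w A).card + k ∧ ExpT G (insert w A) X T)) ∪
            (Finset.univ.filter
              (fun T : Finset V => T.card = A.card + (k+1) ∧ ExpT G A (insert w X) T)) := by
          intro T hT
          simp only [Finset.mem_filter, Finset.mem_univ, true_and, Finset.mem_union] at hT ⊢
          obtain ⟨hc, hA, hX, hE⟩ := hT
          by_cases hwT : w ∈ T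
          · left
            refine ⟨by rw [Finset.card_insert_of_notMem hwA]; omega,
              Finset.insert_subset hwT hA, hX, ?_⟩
            intro S hS
            exact hE S ((Finset.subset_insert _ _).trans hS)
          · right
            refine ⟨hc, hA, ?_, hE⟩
            intro x hx hx'
            rcases Finset.mem_insert.1 hx' with rfl | h
            · exact hwT hx
            · exact hX x hx h
        refine (Finset.card_le_card hsub).trans ((Finset.card_union_le _ _).trans
          ((add_le_add h2 h1).trans ?_))
        have e1 : m + 1 + (k+1) * Δ = (m + (k+1)*Δ) + 1 := by ring
        have e2 : m + Δ + k * Δ = m + (k+1)*Δ := by ring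
        rw [e1, e2, Nat.choose_succ_succ]

theorem num_aux (Δ k : ℕ) :
    ((k + 1) * Δ).choose k ≤ 2 ^ (2 * (k + 1)) * Δ ^ k := by
  have h1 : k.factorial * ((k + 1) * Δ).choose k ≤ ((k + 1) * Δ) ^ k := by
    rw [← Nat.descFactorial_eq_factorial_mul_choose]
    exact Nat.descFactorial_le_pow _ _
  have h2 : (k + 1) ^ k ≤ k.factorial * (k + k).choose k := by
    rw [← Nat.ascFactorial_eq_factorial_mul_choose]
    exact Nat.pow_succ_le_ascFactorial _ _
  have h3 : (k + k).choose k ≤ 2 ^ (2 * (k + 1)) :=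
    (Nat.choose_le_two_pow _ _).trans (Nat.pow_le_pow_right (by norm_num) (by omega))
  refine Nat.le_of_mul_le_mul_left ?_ k.factorial_pos
  calc _ ≤ ((k + 1) * Δ) ^ k := h1
    _ = (k + 1) ^ k * Δ ^ k := mul_pow _ _ _
    _ ≤ (k.factorial * 2 ^ (2 * (k + 1))) * Δ ^ k :=
      Nat.mul_le_mul_right _ (h2.trans (Nat.mul_le_mul_left _ h3))
    _ = _ := by ring

theorem stmt2 {V : Type*} [Fintype V] [DecidableEq V] (G : SimpleGraph V)
    [DecidableRel G.Adj]
    (Δ : ℕ) (hΔ : 1 ≤ Δ) (hdeg : ∀ u : V, G.degree u ≤ Δ)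
    (v : V) (r : ℕ) (hr : 1 ≤ r) :
    ({T : Finset V | T.card = r ∧ v ∈ T ∧ (G.induce (T : Set V)).Connected} :
        Set (Finset V)).ncard ≤ 2 ^ (2 * r) * Δ ^ (r - 1) := by
  classical
  obtain ⟨k, rfl⟩ : ∃ k, r = k + 1 := ⟨r - 1, by omega⟩
  have hd : ∀ u : V, (G.neighborFinset u).card ≤ Δ := hdeg
  have key := count_aux G Δ (by intro u; convert hd u) k Δ {v} ∅ (G.neighborFinset v) (hd v)
    (by
      intro a ha b hab
      rw [Finset.mem_singleton] at ha
      subst ha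
      simp [hab])
  have e : Δ + k * Δ = (k + 1) * Δ := by ring
  rw [e] at key
  refine le_trans ?_ (key.trans (num_aux Δ k))
  rw [← Set.ncard_coe_finset]
  refine Set.ncard_le_ncard ?_ (Set.toFinite _)
  rintro T ⟨hc, hv, hconn⟩
  simp only [Finset.coe_filter, Finset.mem_univ, true_and, Set.mem_setOf_eq]
  refine ⟨by simp [hc, add_comm], by simpa using hv, by simp, ?_⟩
  intro S hvS hST hne
  have hvS' : v ∈ S := by simpa using hvS
  obtain ⟨t, htT, htS⟩ : ∃ t ∈ T, t ∉ S := by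
    by_contra! h
    exact hne (Finset.Subset.antisymm hST h)
  obtain ⟨p⟩ := hconn.preconnected ⟨v, hv⟩ ⟨t, htT⟩
  obtain ⟨d, -, h1, h2⟩ := p.exists_boundary_dart {x | x.1 ∈ S} hvS' htS
  exact ⟨d.fst.1, h1, d.snd.1, d.snd.2, h2, d.adj⟩
end

section
/- Let q be a prime and let D ≥ 1 and r ≥ 1 be natural numbers with r·D < q. For a polynomial P over the field 𝔽_q = ZMod q, let A_P = {(x, P(x)) : x ∈ 𝔽_q} ⊆ 𝔽_q × 𝔽_q be the graph of P. Then for every polynomial P of degree at most D and all polynomials P_1, …, P_r of degree at most D, each distinct from P as a polynomial, the set A_P is not contained in A_{P_1} ∪ ⋯ ∪ A_{P_r}. (In other words, the family of graphs of all polynomials of degree at most D over 𝔽_q is an r-cover-free family of subsets of 𝔽_q × 𝔽_q.) -/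
/-- The graph of a polynomial `P` over `ZMod q`, i.e. the set `{(x, P(x)) : x ∈ ZMod q}`. -/
def polyGraph (q : ℕ) (P : Polynomial (ZMod q)) : Set (ZMod q × ZMod q) :=
  {pt | ∃ x : ZMod q, pt = (x, P.eval x)}

theorem stmt3 (q : ℕ) (hq : q.Prime) (D r : ℕ) (hD : 1 ≤ D) (hr : 1 ≤ r)
    (hrD : r * D < q)
    (P : Polynomial (ZMod q)) (hP : P.natDegree ≤ D)
    (Ps : Fin r → Polynomial (ZMod q)) (hPs : ∀ i, (Ps i).natDegree ≤ D)
    (hne : ∀ i, Ps i ≠ P) :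
    ¬ polyGraph q P ⊆ ⋃ i, polyGraph q (Ps i) := by
  intro hsub
  haveI : Fact q.Prime := ⟨hq⟩
  have hdeg : (∏ i, (Ps i - P)).natDegree < Fintype.card (ZMod q) := by
    rw [ZMod.card]
    refine lt_of_le_of_lt (Polynomial.natDegree_prod_le _ _) (lt_of_le_of_lt ?_ hrD)
    calc ∑ i, (Ps i - P).natDegree ≤ ∑ _i : Fin r, D :=
          Finset.sum_le_sum fun i _ =>
            (Polynomial.natDegree_sub_le _ _).trans (max_le (hPs i) hP)
      _ = r * D := by simp
  have hz : ∏ i, (Ps i - P) = 0 := by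
    refine Polynomial.eq_zero_of_natDegree_lt_card_of_eval_eq_zero _
      (f := fun x : ZMod q => x) Function.injective_id ?_ hdeg
    intro x
    obtain ⟨i, y, hy⟩ := Set.mem_iUnion.1 (hsub ⟨x, rfl⟩)
    obtain ⟨rfl, h2⟩ := Prod.mk.inj hy
    rw [Polynomial.eval_prod]
    exact Finset.prod_eq_zero (Finset.mem_univ i) (by simp [h2])
  obtain ⟨i, _, hi⟩ := Finset.prod_eq_zero_iff.1 hz
  exact hne i (sub_eq_zero.1 hi)
end

section
/- Let G be a finite simple graph equipped with an orientation in which every vertex has at most r out-neighbours, let c : V(G) → I be a proper colouring of G, and let (A_i)_{i∈I} be an injective family of finite subsets of a set U that is r-cover-free. Then: (1) for every vertex v the set A_{c(v)} ∖ ⋃_{w ∈ N⁺(v)} A_{c(w)} is nonempty, where N⁺(v) is the set of out-neighbours of v; and (2) every function c' : V(G) → U satisfying c'(v) ∈ A_{c(v)} ∖ ⋃_{w ∈ N⁺(v)} A_{c(w)} for all v is a proper colouring of G. In particular, G admits a proper colouring with colours in U. -/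
theorem stmt4 {V I U : Type*} [Fintype V] [DecidableEq V] [DecidableEq I] [DecidableEq U]
    (G : SimpleGraph V) (r : ℕ)
    -- an orientation of `G` with at most `r` out-neighbours per vertex,
    -- given by its out-neighbourhood map `out`:
    (out : V → Finset V)
    (hout_adj : ∀ u w, w ∈ out u → G.Adj u w)
    (hout_cov : ∀ u w, G.Adj u w → w ∈ out u ∨ u ∈ out w)
    (hout_card : ∀ u, (out u).card ≤ r)
    -- a proper colouring of `G` with colours in `I`:
    (c : V → I) (hc : ∀ u w, G.Adj u w → c u ≠ c w)
    -- an injective `r`-cover-free family of finite subsets of `U`: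
    (A : I → Finset U) (hA_inj : Function.Injective A)
    (hA_cf : ∀ (i : I) (s : Finset I), s.card ≤ r → i ∉ s → ¬ A i ⊆ s.biUnion A) :
    (∀ v : V, (A (c v) \ (out v).biUnion (fun w => A (c w))).Nonempty) ∧
    (∀ c' : V → U, (∀ v, c' v ∈ A (c v) \ (out v).biUnion (fun w => A (c w))) →
      ∀ u w, G.Adj u w → c' u ≠ c' w) ∧
    (∃ c' : V → U, ∀ u w, G.Adj u w → c' u ≠ c' w) := by
  have h1 : ∀ v : V, (A (c v) \ (out v).biUnion (fun w => A (c w))).Nonempty := by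
    intro v
    rw [Finset.sdiff_nonempty]
    have h := hA_cf (c v) ((out v).image c) (Finset.card_image_le.trans (hout_card v)) (by
      intro hm
      obtain ⟨w, hw, hcw⟩ := Finset.mem_image.1 hm
      exact hc v w (hout_adj v w hw) hcw.symm)
    rwa [Finset.image_biUnion] at h
  have h2 : ∀ c' : V → U, (∀ v, c' v ∈ A (c v) \ (out v).biUnion (fun w => A (c w))) →
      ∀ u w, G.Adj u w → c' u ≠ c' w := by
    intro c' h u w huw he
    have hu := Finset.mem_sdiff.1 (h u)
    have hw := Finset.mem_sdiff.1 (h w)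
    rcases hout_cov u w huw with hm | hm
    · exact hu.2 (Finset.mem_biUnion.2 ⟨w, hm, he ▸ hw.1⟩)
    · exact hw.2 (Finset.mem_biUnion.2 ⟨u, hm, he ▸ hu.1⟩)
  refine ⟨h1, h2, ?_⟩
  choose c' h using h1
  exact ⟨c', h2 c' h⟩
end

section
/- Let G be a finite simple graph that admits an orientation in which every vertex has at most r out-neighbours and that admits a proper colouring with k colours. Let q be a prime and D ≥ 1 a natural number such that r·D < q and k ≤ q^{D+1}. Then G admits a proper colouring with at most q² colours. -/
theorem stmt5 {V : Type*} [Fintype V] [DecidableEq V] (G : SimpleGraph V)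
    (r k q D : ℕ) (hq : q.Prime) (hD : 1 ≤ D) (hrD : r * D < q) (hk : k ≤ q ^ (D + 1))
    -- `G` admits an orientation in which every vertex has at most `r` out-neighbours:
    (hor : ∃ out : V → Finset V,
      (∀ u w, w ∈ out u → G.Adj u w) ∧
      (∀ u w, G.Adj u w → w ∈ out u ∨ u ∈ out w) ∧
      (∀ u, (out u).card ≤ r))
    -- `G` admits a proper colouring with `k` colours:
    (hcol : G.Colorable k) :
    G.Colorable (q ^ 2) := by
  classical
  haveI : Fact q.Prime := ⟨hq⟩
  haveI : NeZero q := ⟨hq.ne_zero⟩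
  obtain ⟨out, h1, h2, h3⟩ := hor
  obtain ⟨c⟩ := hcol
  have hcard : Fintype.card (Fin k) ≤ Fintype.card (Fin (D + 1) → ZMod q) := by
    simpa [ZMod.card] using hk
  obtain ⟨e⟩ := Function.Embedding.nonempty_of_card_le hcard
  let P : V → Polynomial (ZMod q) := fun v =>
    ((Polynomial.degreeLTEquiv (ZMod q) (D + 1)).symm (e (c v)) : Polynomial (ZMod q))
  have hP : ∀ v, (P v).degree < ((D + 1 : ℕ) : WithBot ℕ) := fun v =>
    Polynomial.mem_degreeLT.1 ((Polynomial.degreeLTEquiv (ZMod q) (D + 1)).symm (e (c v))).2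
  have hne : ∀ u w, G.Adj u w → P u - P w ≠ 0 := by
    intro u w h heq
    have h4 := Subtype.ext (sub_eq_zero.1 heq)
    exact c.valid h (e.injective ((Polynomial.degreeLTEquiv (ZMod q) (D + 1)).symm.injective h4))
  have hroots : ∀ u w, G.Adj u w → (P u - P w).roots.toFinset.card ≤ D := by
    intro u w h
    refine (Multiset.toFinset_card_le _).trans ((Polynomial.card_roots' _).trans ?_)
    have h5 : (P u - P w).degree < ((D + 1 : ℕ) : WithBot ℕ) :=
      (Polynomial.degree_sub_le _ _).trans_lt (max_lt (hP u) (hP w))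
    have h6 := (Polynomial.natDegree_lt_iff_degree_lt (hne u w h)).2 h5
    omega
  have hx : ∀ u, ∃ x : ZMod q, ∀ w ∈ out u, (P u).eval x ≠ (P w).eval x := by
    intro u
    have hb : ((out u).biUnion fun w => (P u - P w).roots.toFinset).card < q := by
      refine (Finset.card_biUnion_le_card_mul _ _ D fun w hw => hroots u w (h1 u w hw)).trans_lt ?_
      exact (Nat.mul_le_mul_right D (h3 u)).trans_lt hrD
    have : ∃ x : ZMod q, x ∉ (out u).biUnion fun w => (P u - P w).roots.toFinset := by
      by_contra! hcon
      rw [Finset.eq_univ_iff_forall.2 hcon, Finset.card_univ, ZMod.card] at hb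
      exact lt_irrefl _ hb
    obtain ⟨x, hx⟩ := this
    refine ⟨x, fun w hw heq => hx ?_⟩
    rw [Finset.mem_biUnion]
    refine ⟨w, hw, ?_⟩
    rw [Multiset.mem_toFinset, Polynomial.mem_roots (hne u w (h1 u w hw))]
    simp [Polynomial.IsRoot, heq]
  choose x hx using hx
  let C : G.Coloring (ZMod q × ZMod q) := SimpleGraph.Coloring.mk
    (fun v => (x v, (P v).eval (x v))) (by
      intro u w h heq
      have ha : x u = x w := congrArg Prod.fst heq
      have hb : (P u).eval (x u) = (P w).eval (x w) := congrArg Prod.snd heq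
      rcases h2 u w h with h | h
      · exact hx u w h (by rw [hb, ha])
      · exact hx w u h (by rw [← hb, ha]))
  have := C.colorable
  simpa [ZMod.card, sq] using this
end

section
/- Let G be a finite simple graph equipped with an orientation in which every vertex has at most d out-neighbours. Let U be a subset of the vertices, let C be a set of colours, let S ⊆ C with |S| = 3d + 1, and let κ : V(G) ∖ U → C be a proper colouring of the induced subgraph G[V(G) ∖ U]. Suppose that every vertex w ∉ U with κ(w) ∈ S has no out-neighbour lying in U. Then there exists κ' : U → S such that the combined colouring (equal to κ on V(G) ∖ U and to κ' on U) is a proper colouring of all of G. -/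
theorem stmt6 {V C : Type*} [Fintype V] [DecidableEq V] [DecidableEq C]
    (G : SimpleGraph V) (d : ℕ)
    -- an orientation of `G` with at most `d` out-neighbours per vertex:
    (out : V → Finset V)
    (hout_adj : ∀ u w, w ∈ out u → G.Adj u w)
    (hout_cov : ∀ u w, G.Adj u w → w ∈ out u ∨ u ∈ out w)
    (hout_card : ∀ u, (out u).card ≤ d)
    (U : Set V) [DecidablePred (· ∈ U)]
    (S : Finset C) (hS : S.card = 3 * d + 1)
    -- `κ` is a proper colouring of the subgraph induced by the complement of `U`:
    (κ : V → C)
    (hκ : ∀ u ∉ U, ∀ w ∉ U, G.Adj u w → κ u ≠ κ w)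
    -- every vertex outside `U` coloured with a colour of `S` has no out-neighbour in `U`:
    (hbound : ∀ w ∉ U, κ w ∈ S → ∀ u ∈ out w, u ∉ U) :
    ∃ κ' : V → C, (∀ u ∈ U, κ' u ∈ S) ∧
      (∀ u w, G.Adj u w →
        (if u ∈ U then κ' u else κ u) ≠ (if w ∈ U then κ' w else κ w)) := by
  classical
  have key : ∀ W : Finset V, (∀ u ∈ W, u ∈ U) → ∃ f : V → C, (∀ u ∈ W, f u ∈ S) ∧
      (∀ u ∈ W, ∀ w ∈ W, G.Adj u w → f u ≠ f w) ∧
      (∀ u ∈ W, ∀ w ∈ out u, w ∉ U → f u ≠ κ w) := by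
    intro W
    induction W using Finset.strongInduction with
    | H W ih =>
      intro hW
      rcases W.eq_empty_or_nonempty with rfl | hne
      · exact ⟨κ, by simp, by simp, by simp⟩
      have hv : ∃ v ∈ W, (W.filter (fun w => v ∈ out w)).card ≤ d := by
        by_contra! hcon
        have h1 : ∑ v ∈ W, (W.filter (fun w => v ∈ out w)).card
            = ∑ w ∈ W, (W.filter (fun v => v ∈ out w)).card :=
          Finset.sum_card_bipartiteAbove_eq_sum_card_bipartiteBelow (fun v w => v ∈ out w)
        have h2 : ∑ w ∈ W, (W.filter (fun v => v ∈ out w)).card ≤ ∑ w ∈ W, d := by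
          apply Finset.sum_le_sum
          intro w _
          refine (Finset.card_le_card ?_).trans (hout_card w)
          intro x hx
          exact (Finset.mem_filter.1 hx).2
        have h3 : ∑ w ∈ W, d < ∑ v ∈ W, (W.filter (fun w => v ∈ out w)).card :=
          Finset.sum_lt_sum_of_nonempty hne hcon
        omega
      obtain ⟨v, hvW, hvd⟩ := hv
      obtain ⟨f, hf1, hf2, hf3⟩ := ih (W.erase v) (Finset.erase_ssubset hvW)
        (fun u hu => hW u (Finset.mem_of_mem_erase hu))
      let g : V → C := fun w => if w ∈ U then f w else κ w
      let B : Finset C := (out v ∪ W.filter (fun w => v ∈ out w)).image g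
      have hB : B.card < S.card := by
        have a1 : B.card ≤ (out v ∪ W.filter (fun w => v ∈ out w)).card :=
          Finset.card_image_le
        have a2 := Finset.card_union_le (out v) (W.filter (fun w => v ∈ out w))
        have a3 := hout_card v
        omega
      obtain ⟨c, hcS, hcB⟩ := Finset.exists_mem_notMem_of_card_lt_card hB
      have hc : ∀ w, (w ∈ out v ∨ (w ∈ W ∧ v ∈ out w)) → c ≠ g w := by
        intro w hw h
        apply hcB
        rw [h]
        apply Finset.mem_image_of_mem
        simpa using hw
      have hc2 : ∀ w ∈ W, G.Adj v w → c ≠ f w := by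
        intro w hw ha
        have h := hc w ((hout_cov v w ha).imp id (fun h => ⟨hw, h⟩))
        simpa [g, hW w hw] using h
      refine ⟨Function.update f v c, ?_, ?_, ?_⟩
      · intro u hu
        by_cases huv : u = v
        · subst huv; simpa using hcS
        · simpa [huv] using hf1 u (Finset.mem_erase.2 ⟨huv, hu⟩)
      · intro u hu w hw ha
        by_cases huv : u = v
        · subst huv
          have hwu : w ≠ u := ha.ne.symm
          simpa [hwu] using hc2 w hw ha
        · by_cases hwv : w = v
          · subst hwv
            simpa [huv] using (hc2 u hu ha.symm).symm
          · simpa [huv, hwv] using hf2 u (Finset.mem_erase.2 ⟨huv, hu⟩) w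
              (Finset.mem_erase.2 ⟨hwv, hw⟩) ha
      · intro u hu w hw hwU
        by_cases huv : u = v
        · subst huv
          have h := hc w (Or.inl hw)
          simpa [g, hwU] using h
        · simpa [huv] using hf3 u (Finset.mem_erase.2 ⟨huv, hu⟩) w hw hwU
  obtain ⟨f, hf1, hf2, hf3⟩ := key (Finset.univ.filter (· ∈ U)) (by simp)
  simp only [Finset.mem_filter, Finset.mem_univ, true_and] at hf1 hf2 hf3
  have mixed : ∀ u ∈ U, ∀ w ∉ U, G.Adj u w → f u ≠ κ w := by
    intro u hu w hw ha h
    rcases hout_cov u w ha with h1 | h1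
    · exact hf3 u hu w h1 hw h
    · exact hbound w hw (h ▸ hf1 u hu) u h1 hu
  refine ⟨f, hf1, ?_⟩
  intro u w ha
  by_cases hu : u ∈ U <;> by_cases hw : w ∈ U
  · simpa only [hu, hw, if_true] using hf2 u hu w hw ha
  · simpa only [hu, hw, if_true, if_false] using mixed u hu w hw ha
  · simpa only [hu, hw, if_true, if_false] using (mixed w hw u hu ha.symm).symm
  · simpa only [hu, hw, if_false] using hκ u hu w hw ha
end

section
/- If a finite simple graph G admits an orientation in which every vertex has out-degree at most d, then G admits an acyclic orientation in which every vertex has out-degree at most 2d. -/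
theorem stmt7_low {V : Type*} [DecidableEq V] (out : V → Finset V) (d : ℕ)
    (h : ∀ u, (out u).card ≤ d) (S : Finset V) (hS : S.Nonempty) :
    ∃ v ∈ S, (S.filter (fun w => w ∈ out v ∨ v ∈ out w)).card ≤ 2 * d := by
  by_contra hc
  push Not at hc
  have h1 : ∑ v ∈ S, 2 * d < ∑ v ∈ S, (S.filter (fun w => w ∈ out v ∨ v ∈ out w)).card :=
    Finset.sum_lt_sum_of_nonempty hS hc
  have h2 : ∑ v ∈ S, (S.filter (fun w => w ∈ out v ∨ v ∈ out w)).card ≤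
      ∑ v ∈ S, ((S.filter (fun w => w ∈ out v)).card + (S.filter (fun w => v ∈ out w)).card) := by
    apply Finset.sum_le_sum
    intro v _
    rw [Finset.filter_or]
    exact Finset.card_union_le _ _
  have h3 : ∑ v ∈ S, (S.filter (fun w => v ∈ out w)).card =
      ∑ v ∈ S, (S.filter (fun w => w ∈ out v)).card := by
    simp only [Finset.card_filter]
    exact Finset.sum_comm
  have h4 : ∑ v ∈ S, (S.filter (fun w => w ∈ out v)).card ≤ ∑ v ∈ S, d := by
    apply Finset.sum_le_sum
    intro v _
    refine le_trans (Finset.card_le_card ?_) (h v)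
    intro w hw
    exact (Finset.mem_filter.1 hw).2
  rw [Finset.sum_add_distrib, h3] at h2
  rw [← Finset.mul_sum] at h1
  omega

theorem stmt7_rank {V : Type*} [DecidableEq V] (out : V → Finset V) (d : ℕ)
    (h : ∀ u, (out u).card ≤ d) (S : Finset V) :
    ∃ r : V → ℕ, Set.InjOn r S ∧ ∀ v ∈ S,
      (S.filter (fun w => (w ∈ out v ∨ v ∈ out w) ∧ r v < r w)).card ≤ 2 * d := by
  induction S using Finset.strongInduction with
  | H S ih =>
    rcases S.eq_empty_or_nonempty with rfl | hS
    · exact ⟨fun _ => 0, by simp, by simp⟩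
    obtain ⟨v, hv, hd⟩ := stmt7_low out d h S hS
    obtain ⟨r, hr, hb⟩ := ih (S.erase v) (Finset.erase_ssubset hv)
    refine ⟨fun w => if w = v then 0 else r w + 1, ?_, ?_⟩
    · intro a ha b hb' hab
      have := @hr a
      by_cases h1 : a = v <;> by_cases h2 : b = v <;> simp [h1, h2] at hab ⊢
      exact hr (by simp_all) (by simp_all) hab
    · intro u hu
      by_cases huv : u = v
      · subst huv
        refine le_trans (Finset.card_le_card ?_) hd
        intro w hw
        simp only [Finset.mem_filter] at hw ⊢
        exact ⟨hw.1, hw.2.1⟩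
      · refine le_trans (Finset.card_le_card ?_) (hb u (Finset.mem_erase.2 ⟨huv, hu⟩))
        intro w hw
        simp only [Finset.mem_filter, Finset.mem_erase, if_neg huv] at hw ⊢
        by_cases hwv : w = v
        · simp [hwv] at hw
        · simp only [if_neg hwv] at hw
          exact ⟨⟨hwv, hw.1⟩, hw.2.1, by omega⟩

theorem stmt7 {V : Type*} [Fintype V] [DecidableEq V] (G : SimpleGraph V) (d : ℕ)
    -- `G` admits an orientation in which every vertex has out-degree at most `d`:
    (hor : ∃ out : V → Finset V,
      (∀ u w, w ∈ out u → G.Adj u w) ∧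
      (∀ u w, G.Adj u w → w ∈ out u ∨ u ∈ out w) ∧
      (∀ u, (out u).card ≤ d)) :
    -- then `G` admits an acyclic orientation with out-degree at most `2d`:
    ∃ out : V → Finset V,
      (∀ u w, w ∈ out u → G.Adj u w) ∧
      (∀ u w, G.Adj u w → w ∈ out u ∨ u ∈ out w) ∧
      (∀ u, (out u).card ≤ 2 * d) ∧
      (∀ v, ¬ Relation.TransGen (fun a b => b ∈ out a) v v) := by
  obtain ⟨out, h1, h2, h3⟩ := hor
  obtain ⟨r, hr, hb⟩ := stmt7_rank out d h3 Finset.univ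
  refine ⟨fun v => Finset.univ.filter (fun w => (w ∈ out v ∨ v ∈ out w) ∧ r v < r w),
    ?_, ?_, fun u => hb u (Finset.mem_univ u), ?_⟩
  · intro u w hw
    rcases (Finset.mem_filter.1 hw).2.1 with h | h
    · exact h1 _ _ h
    · exact (h1 _ _ h).symm
  · intro u w huw
    have hne : r u ≠ r w := fun h => huw.ne (hr (by simp) (by simp) h)
    have := h2 u w huw
    simp only [Finset.mem_filter, Finset.mem_univ, true_and]
    rcases lt_or_gt_of_ne hne with h | h
    · exact Or.inl ⟨this, h⟩
    · exact Or.inr ⟨this.symm, h⟩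
  · intro v hv
    have key : ∀ a b, Relation.TransGen (fun a b => b ∈ Finset.univ.filter
        (fun w => (w ∈ out a ∨ a ∈ out w) ∧ r a < r w)) a b → r a < r b := by
      intro a b hab
      induction hab with
      | single h => exact (Finset.mem_filter.1 h).2.2
      | tail _ h ih => exact ih.trans (Finset.mem_filter.1 h).2.2
    exact lt_irrefl _ (key v v hv)
end

section
/- Let G be a finite simple graph equipped with an orientation in which every vertex has at most d out-neighbours, where d ≥ 2. Set L = 4⌈log₂ d⌉ and m = 8d⌈log₂ d⌉. Suppose that each vertex v independently chooses colours X_{v,1}, …, X_{v,L}, where X_{v,i} is uniform on a palette of size m (the palettes for different indices i being disjoint, and all choices of all vertices being mutually independent). Say that v fails if for every i ∈ {1,…,L} some out-neighbour w of v has X_{w,i} = X_{v,i}. Then for every fixed vertex v, conditionally on any fixed values of the colour choices of all vertices other than v, the probability that v fails is at most d^{−4}. -/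
open MeasureTheory ENNReal NNReal

theorem stmt8 {V : Type*} [Fintype V] [DecidableEq V] (G : SimpleGraph V)
    (d : ℕ) (hd : 2 ≤ d)
    -- an orientation of `G` with at most `d` out-neighbours per vertex:
    (out : V → Finset V)
    (hout_adj : ∀ u w, w ∈ out u → G.Adj u w)
    (hout_cov : ∀ u w, G.Adj u w → w ∈ out u ∨ u ∈ out w)
    (hout_card : ∀ u, (out u).card ≤ d)
    -- `L = 4⌈log₂ d⌉` colours per vertex, each uniform on a palette of size `m = 8d⌈log₂ d⌉`;
    -- conditioning on arbitrary fixed values `Y` of the colour choices of all other vertices: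
    (L m : ℕ) (hL : L = 4 * Nat.clog 2 d) (hm : m = 8 * d * Nat.clog 2 d) [NeZero m]
    (v : V) (Y : V → Fin L → Fin m) :
    (PMF.uniformOfFintype (Fin L → Fin m)).toMeasure
        {x : Fin L → Fin m | ∀ i : Fin L, ∃ w ∈ out v, Y w i = x i}
      ≤ ((d : ℝ≥0∞) ^ 4)⁻¹ := by
  classical
  have hc : 1 ≤ Nat.clog 2 d := Nat.clog_pos (by norm_num) hd
  have hdc : d ≤ 2 ^ Nat.clog 2 d := Nat.le_pow_clog (by norm_num) d
  have hset : {x : Fin L → Fin m | ∀ i : Fin L, ∃ w ∈ out v, Y w i = x i}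
      = ((Fintype.piFinset fun i => (out v).image fun w => Y w i : Finset (Fin L → Fin m)) :
        Set (Fin L → Fin m)) := by
    ext x
    simp [Fintype.mem_piFinset]
  have hcard : (Fintype.piFinset fun i : Fin L => (out v).image fun w => Y w i).card ≤ d ^ L := by
    rw [Fintype.card_piFinset]
    calc _ ≤ ∏ _i : Fin L, d := Finset.prod_le_prod' fun i _ =>
            Finset.card_image_le.trans (hout_card v)
      _ = d ^ L := by simp
  have hnat : d ^ L * d ^ 4 ≤ m ^ L := by
    have h1 : d ^ 4 ≤ (8 * Nat.clog 2 d) ^ L := by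
      calc d ^ 4 ≤ (2 ^ Nat.clog 2 d) ^ 4 := Nat.pow_le_pow_left hdc 4
        _ = 2 ^ L := by rw [← pow_mul, hL, mul_comm]
        _ ≤ _ := Nat.pow_le_pow_left (by omega) L
    calc d ^ L * d ^ 4 ≤ d ^ L * (8 * Nat.clog 2 d) ^ L := Nat.mul_le_mul_left _ h1
      _ = m ^ L := by rw [← mul_pow, hm]; congr 1; ring
  rw [hset, PMF.toMeasure_uniformOfFintype_apply _ (Set.toFinite _).measurableSet]
  simp only [Fintype.card_coe, Finset.coe_sort_coe, Fintype.card_fun, Fintype.card_fin]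
  have hd0 : ((d : ℝ≥0∞) ^ 4) ≠ 0 := by
    have : d ≠ 0 := by omega
    positivity
  have hdt : ((d : ℝ≥0∞) ^ 4) ≠ ∞ := by finiteness
  apply ENNReal.div_le_of_le_mul
  rw [mul_comm, ← div_eq_mul_inv, ENNReal.le_div_iff_mul_le (Or.inl hd0) (Or.inl hdt)]
  exact_mod_cast (Nat.mul_le_mul_right _ hcard).trans hnat
end

section
/- Let G be a finite simple graph on n vertices with n ≥ 2, equipped with an orientation in which every vertex has at most d out-neighbours, where d ≥ 2, and let c ≥ 1 be a real number. Run the random colour experiment in which each vertex v independently chooses, for each i ∈ {1,…,4⌈log₂ d⌉}, a colour X_{v,i} uniformly from a palette of size 8d⌈log₂ d⌉ (palettes for distinct i disjoint, all choices independent), and say v fails if for every i some out-neighbour w of v has X_{w,i} = X_{v,i}. For each vertex v, let R(v) be the set of failed vertices reachable from v by directed paths (following out-edges) passing only through failed vertices. Then, with probability at least 1 − n^{−c}, every vertex v satisfies |R(v)| ≤ (c+1)·(log n)/(log d). -/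
open MeasureTheory ENNReal NNReal

/-- `v` fails its colour experiment: for every index `i`, some out-neighbour `w` of `v`
chose the same colour `X w i = X v i`. -/
def failed {V : Type*} (out : V → Finset V) {L m : ℕ}
    (X : V → Fin L → Fin m) (v : V) : Prop :=
  ∀ i : Fin L, ∃ w ∈ out v, X w i = X v i

/-- The set of failed vertices reachable from `v` by directed paths (following out-edges)
passing only through failed vertices. -/
def failReach {V : Type*} (out : V → Finset V) {L m : ℕ}
    (X : V → Fin L → Fin m) (v : V) : Set V :=
  {u | failed out X u ∧
    Relation.ReflTransGen
      (fun a b => b ∈ out a ∧ failed out X a ∧ failed out X b) v u}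


section helpers
open Finset

lemma core_det {V : Type*} [Fintype V] [DecidableEq V] (m : ℕ) (B : Finset V) (g : V → V)
    (r : V → ℕ) (h : ∀ v ∈ B, r (g v) < r v) :
    (univ.filter (fun x : V → Fin m => ∀ v ∈ B, x (g v) = x v)).card * m ^ B.card
      ≤ m ^ Fintype.card V := by
  have h1 : (univ.filter (fun x : V → Fin m => ∀ v ∈ B, x (g v) = x v)).card ≤
      (univ : Finset ({v : V // v ∉ B} → Fin m)).card := by
    apply card_le_card_of_injOn (fun x => fun v => x v.1)
    · intro x _; simp
    · intro x hx y hy hxy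
      simp only [coe_filter, mem_univ, true_and, Set.mem_ofPred_eq] at hx hy
      have key : ∀ N : ℕ, ∀ v, r v < N → x v = y v := by
        intro N
        induction N with
        | zero => intro v hv; omega
        | succ N ih =>
          intro v hv
          by_cases hB : v ∈ B
          · rw [← hx v hB, ← hy v hB]
            exact ih _ (by have := h v hB; omega)
          · exact congrFun hxy ⟨v, hB⟩
      funext v
      exact key _ v (Nat.lt_succ_self _)
  have h2 : (univ : Finset ({v : V // v ∉ B} → Fin m)).card = m ^ (Fintype.card V - B.card) := by
    rw [card_univ, Fintype.card_fun, Fintype.card_fin]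
    congr 1
    rw [Fintype.card_subtype_compl]
    simp
  calc _ ≤ m ^ (Fintype.card V - B.card) * m ^ B.card := Nat.mul_le_mul_right _ (h2 ▸ h1)
    _ = m ^ Fintype.card V := by
      rw [← pow_add, Nat.sub_add_cancel (card_le_univ B)]

lemma core_union {V : Type*} [Fintype V] [DecidableEq V] (m d : ℕ) (B : Finset V)
    (out : V → Finset V) (hd : ∀ v, (out v).card ≤ d)
    (r : V → ℕ) :
    (univ.filter (fun x : V → Fin m => ∀ v ∈ B, ∃ w ∈ out v, r w < r v ∧ x w = x v)).card
      * m ^ B.card ≤ d ^ B.card * m ^ Fintype.card V := by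
  set P : Finset (V → V) := Fintype.piFinset
    (fun v => if v ∈ B then (out v).filter (fun w => r w < r v) else {v}) with hP
  have hPc : P.card ≤ d ^ B.card := by
    rw [hP, Fintype.card_piFinset]
    calc _ ≤ ∏ v : V, (if v ∈ B then d else 1) := by
          apply prod_le_prod' 
          intro v _
          split_ifs
          · exact (card_filter_le _ _).trans (hd v)
          · simp
      _ = d ^ B.card := by
          rw [prod_ite_mem]; simp
  have hsub : univ.filter (fun x : V → Fin m => ∀ v ∈ B, ∃ w ∈ out v, r w < r v ∧ x w = x v) ⊆
      P.biUnion (fun g => univ.filter (fun x : V → Fin m => ∀ v ∈ B, x (g v) = x v)) := by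
    intro x hx
    simp only [mem_filter, mem_univ, true_and] at hx
    choose! g hg using hx
    simp only [mem_biUnion, mem_filter, mem_univ, true_and]
    refine ⟨fun v => if v ∈ B then g v else v, ?_, ?_⟩
    · rw [hP, Fintype.mem_piFinset]
      intro v
      by_cases hv : v ∈ B
      · simp [hv, (hg v hv).1, (hg v hv).2.1]
      · simp [hv]
    · intro v hv
      simp [hv, (hg v hv).2.2]
  calc _ ≤ (∑ g ∈ P, (univ.filter (fun x : V → Fin m => ∀ v ∈ B, x (g v) = x v)).card)
          * m ^ B.card := Nat.mul_le_mul_right _ ((card_le_card hsub).trans card_biUnion_le)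
    _ = ∑ g ∈ P, (univ.filter (fun x : V → Fin m => ∀ v ∈ B, x (g v) = x v)).card
          * m ^ B.card := by rw [sum_mul]
    _ ≤ ∑ g ∈ P, m ^ Fintype.card V := by
        apply sum_le_sum
        intro g hg
        apply core_det m B g r
        intro v hv
        have := (Fintype.mem_piFinset.1 (hP ▸ hg)) v
        simp only [hv, if_true, mem_filter] at this
        exact this.2
    _ = P.card * m ^ Fintype.card V := by simp
    _ ≤ _ := Nat.mul_le_mul_right _ hPc

lemma four_le (k t : ℕ) (h : k ≤ 2 * t) : 4 ^ k ≤ 16 ^ t := by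
  calc 4 ^ k ≤ 4 ^ (2 * t) := Nat.pow_le_pow_right (by norm_num) h
    _ = 16 ^ t := by rw [pow_mul]; norm_num

lemma exists_rank (V : Type*) [Fintype V] : ∃ r : V → ℕ, Function.Injective r ∧
    ∀ v, r v < Fintype.card V :=
  ⟨fun v => (Fintype.equivFin V v : ℕ), fun a b h => (Fintype.equivFin V).injective (Fin.ext h),
    fun v => (Fintype.equivFin V v).2⟩

lemma half_two {V : Type*} [Fintype V] [DecidableEq V] (out : V → Finset V)
    (hir : ∀ v, v ∉ out v) (hd : ∀ v, (out v).card ≤ 2) (S : Finset V) :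
    (univ.filter (fun x : V → Fin 16 => ∀ v ∈ S, ∃ w ∈ out v, x w = x v)).card * 2 ^ S.card
      ≤ 16 ^ Fintype.card V := by
  obtain ⟨r, hr, hrn⟩ := exists_rank V
  set P : Finset (V → V) := Fintype.piFinset
    (fun v => if v ∈ S then out v else {v}) with hP
  have hPc : P.card ≤ 2 ^ S.card := by
    rw [hP, Fintype.card_piFinset]
    calc _ ≤ ∏ v : V, (if v ∈ S then 2 else 1) := by
          apply prod_le_prod' 
          intro v _
          split_ifs
          · exact hd v
          · simp
      _ = 2 ^ S.card := by
          rw [prod_ite_mem]; simp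
  have hsub : univ.filter (fun x : V → Fin 16 => ∀ v ∈ S, ∃ w ∈ out v, x w = x v) ⊆
      P.biUnion (fun g => univ.filter (fun x : V → Fin 16 => ∀ v ∈ S, x (g v) = x v)) := by
    intro x hx
    simp only [mem_filter, mem_univ, true_and] at hx
    choose! g hg using hx
    simp only [mem_biUnion, mem_filter, mem_univ, true_and]
    refine ⟨fun v => if v ∈ S then g v else v, ?_, ?_⟩
    · rw [hP, Fintype.mem_piFinset]
      intro v
      by_cases hv : v ∈ S
      · simp [hv, (hg v hv).1]
      · simp [hv]
    · intro v hv
      simp [hv, (hg v hv).2]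
  have hmain : (univ.filter (fun x : V → Fin 16 => ∀ v ∈ S, ∃ w ∈ out v, x w = x v)).card
      * 4 ^ S.card ≤ 2 ^ S.card * 16 ^ Fintype.card V := by
    calc _ ≤ (∑ g ∈ P, (univ.filter (fun x : V → Fin 16 => ∀ v ∈ S, x (g v) = x v)).card)
          * 4 ^ S.card := Nat.mul_le_mul_right _ ((card_le_card hsub).trans card_biUnion_le)
      _ = ∑ g ∈ P, (univ.filter (fun x : V → Fin 16 => ∀ v ∈ S, x (g v) = x v)).card
          * 4 ^ S.card := by rw [sum_mul]
      _ ≤ ∑ g ∈ P, 16 ^ Fintype.card V := by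
        apply sum_le_sum
        intro g hg
        have hgo : ∀ v ∈ S, r (g v) ≠ r v := by
          intro v hv he
          have := (Fintype.mem_piFinset.1 (hP ▸ hg)) v
          simp only [hv, if_true] at this
          rw [hr he] at this
          exact hir v this
        have aux : ∀ B ⊆ S, ∀ r' : V → ℕ, (∀ v ∈ B, r' (g v) < r' v) → S.card ≤ 2 * B.card →
            (univ.filter (fun x : V → Fin 16 => ∀ v ∈ S, x (g v) = x v)).card
          * 4 ^ S.card ≤ 16 ^ Fintype.card V := by
          intro B hB r' h' hc
          refine le_trans ?_ (core_det 16 B g r' h')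
          refine Nat.mul_le_mul (card_le_card ?_) (four_le _ _ hc)
          intro x hx
          simp only [mem_filter, mem_univ, true_and] at hx ⊢
          exact fun v hv => hx v (hB hv)
        have hsum := card_filter_add_card_filter_not (s := S) (fun v => r (g v) < r v)
        by_cases hc : S.card ≤ 2 * (S.filter (fun v => r (g v) < r v)).card
        · exact aux _ (filter_subset _ _) r (by simp) hc
        · refine aux (S.filter (fun v => ¬ r (g v) < r v)) (filter_subset _ _)
            (fun v => Fintype.card V - r v) ?_ (by omega)
          intro v hv
          rw [mem_filter] at hv
          have := hgo v hv.1
          have := hrn v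
          have := hrn (g v)
          have := hv.2
          show Fintype.card V - r (g v) < Fintype.card V - r v
          omega
      _ = P.card * 16 ^ Fintype.card V := by simp
      _ ≤ _ := Nat.mul_le_mul_right _ hPc
  have h4 : 4 ^ S.card = 2 ^ S.card * 2 ^ S.card := by rw [← mul_pow]; norm_num
  rw [h4] at hmain
  have : 0 < 2 ^ S.card := by positivity
  nlinarith

lemma half_big {V : Type*} [Fintype V] [DecidableEq V] (out : V → Finset V)
    (hir : ∀ v, v ∉ out v) (d q : ℕ) (hd0 : 0 < d) (hq : 16 ≤ q)
    (hd : ∀ v, (out v).card ≤ d) (S : Finset V) :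
    (univ.filter (fun x : V → Fin (d * q) => ∀ v ∈ S, ∃ w ∈ out v, x w = x v)).card * 2 ^ S.card
      ≤ (d * q) ^ Fintype.card V := by
  obtain ⟨r, hr, hrn⟩ := exists_rank V
  set E : Finset V → Finset (V → Fin (d * q)) := fun B => univ.filter (fun x =>
    (∀ v ∈ B, ∃ w ∈ out v, r w < r v ∧ x w = x v) ∧
    (∀ v ∈ S \ B, ∃ w ∈ out v, Fintype.card V - r w < Fintype.card V - r v ∧ x w = x v)) with hE
  have hsub : univ.filter (fun x : V → Fin (d * q) => ∀ v ∈ S, ∃ w ∈ out v, x w = x v) ⊆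
      S.powerset.biUnion E := by
    intro x hx
    simp only [mem_filter, mem_univ, true_and] at hx
    simp only [mem_biUnion, hE, mem_filter, mem_univ, true_and, mem_powerset]
    refine ⟨S.filter (fun v => ∃ w ∈ out v, r w < r v ∧ x w = x v), filter_subset _ _, ?_, ?_⟩
    · intro v hv
      exact (mem_filter.1 hv).2
    · intro v hv
      simp only [mem_sdiff, mem_filter, not_and] at hv
      obtain ⟨hv, hv2⟩ := hv
      obtain ⟨w, hw, hxw⟩ := hx v hv
      refine ⟨w, hw, ?_, hxw⟩
      have h1 : ¬ r w < r v := fun h => hv2 hv ⟨w, hw, h, hxw⟩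
      have h2 : r w ≠ r v := fun h => hir v (hr h ▸ hw)
      have := hrn v
      have := hrn w
      omega
  have hEc : ∀ B ∈ S.powerset, (E B).card * 4 ^ S.card ≤ (d * q) ^ Fintype.card V := by
    intro B hB
    rw [mem_powerset] at hB
    have aux : ∀ C : Finset V, ∀ r' : V → ℕ,
        E B ⊆ univ.filter (fun x => ∀ v ∈ C, ∃ w ∈ out v, r' w < r' v ∧ x w = x v) →
        S.card ≤ 2 * C.card → (E B).card * 4 ^ S.card ≤ (d * q) ^ Fintype.card V := by
      intro C r' hC hc
      have h1 := core_union (d * q) d C out hd r'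
      have h2 : (E B).card * q ^ C.card ≤ (d * q) ^ Fintype.card V := by
        have h3 := (Nat.mul_le_mul_right ((d * q) ^ C.card) (card_le_card hC)).trans h1
        rw [mul_pow d q C.card, mul_left_comm] at h3
        exact Nat.le_of_mul_le_mul_left h3 (by positivity)
      refine le_trans (Nat.mul_le_mul_left _ ?_) h2
      exact (four_le _ _ hc).trans (Nat.pow_le_pow_left hq _)
    have hsum : (S \ B).card + B.card = S.card := card_sdiff_add_card_eq_card hB
    by_cases hc : S.card ≤ 2 * B.card
    · refine aux B r ?_ hc
      intro x hx
      simp only [hE, mem_filter, mem_univ, true_and] at hx ⊢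
      exact hx.1
    · refine aux (S \ B) (fun v => Fintype.card V - r v) ?_ (by omega)
      intro x hx
      simp only [hE, mem_filter, mem_univ, true_and] at hx ⊢
      exact hx.2
  have hmain : (univ.filter (fun x : V → Fin (d * q) => ∀ v ∈ S, ∃ w ∈ out v, x w = x v)).card
      * 4 ^ S.card ≤ 2 ^ S.card * (d * q) ^ Fintype.card V := by
    calc _ ≤ (∑ B ∈ S.powerset, (E B).card) * 4 ^ S.card :=
          Nat.mul_le_mul_right _ ((card_le_card hsub).trans card_biUnion_le)
      _ = ∑ B ∈ S.powerset, (E B).card * 4 ^ S.card := by rw [sum_mul]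
      _ ≤ ∑ B ∈ S.powerset, (d * q) ^ Fintype.card V := sum_le_sum hEc
      _ = _ := by simp
  have h4 : 4 ^ S.card = 2 ^ S.card * 2 ^ S.card := by rw [← mul_pow]; norm_num
  rw [h4] at hmain
  have : 0 < 2 ^ S.card := by positivity
  nlinarith

lemma half_all {V : Type*} [Fintype V] [DecidableEq V] (out : V → Finset V)
    (hir : ∀ v, v ∉ out v) (d m : ℕ) (hd2 : 2 ≤ d) (hm : m = 8 * d * Nat.clog 2 d)
    (hd : ∀ v, (out v).card ≤ d) (S : Finset V) :
    (univ.filter (fun x : V → Fin m => ∀ v ∈ S, ∃ w ∈ out v, x w = x v)).card * 2 ^ S.card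
      ≤ m ^ Fintype.card V := by
  rcases Nat.lt_or_ge 2 d with h | h
  · have hl : 2 ≤ Nat.clog 2 d := by
      have : 1 < Nat.clog 2 d := (Nat.lt_clog_iff_pow_lt (by norm_num)).2 (by simpa using h)
      omega
    have : m = d * (8 * Nat.clog 2 d) := by rw [hm]; ring
    subst this
    exact half_big out hir d _ (by omega) (by omega) hd S
  · have : d = 2 := by omega
    subst this
    have : m = 16 := by
      rw [hm]
      have : Nat.clog 2 2 = 1 := by
        simpa using Nat.clog_pow 2 1 (by norm_num)
      rw [this]
    subst this
    exact half_two out hir hd S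

instance {V : Type*} [DecidableEq V] (out : V → Finset V) {L m : ℕ}
    (X : V → Fin L → Fin m) (v : V) : Decidable (failed out X v) := by
  unfold failed; infer_instance

lemma fail_count {V : Type*} [Fintype V] [DecidableEq V] (out : V → Finset V)
    (hir : ∀ v, v ∉ out v) (d m L : ℕ) (hd2 : 2 ≤ d) (hm : m = 8 * d * Nat.clog 2 d)
    (hd : ∀ v, (out v).card ≤ d) (S : Finset V) :
    (univ.filter (fun X : V → Fin L → Fin m => ∀ v ∈ S, failed out X v)).card * (2 ^ S.card) ^ L
      ≤ (m ^ Fintype.card V) ^ L := by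
  set A := univ.filter (fun x : V → Fin m => ∀ v ∈ S, ∃ w ∈ out v, x w = x v) with hA
  have h1 : (univ.filter (fun X : V → Fin L → Fin m => ∀ v ∈ S, failed out X v)).card ≤
      (Fintype.piFinset (fun _ : Fin L => A)).card := by
    apply card_le_card_of_injOn (fun X => fun i v => X v i)
    · intro X hX
      simp only [coe_filter, mem_univ, true_and, Set.mem_ofPred_eq] at hX
      simp only [mem_coe, Fintype.mem_piFinset, hA, mem_filter, mem_univ, true_and]
      intro i v hv
      exact hX v hv i
    · intro X _ Y _ h
      funext v i
      exact congrFun (congrFun h i) v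
  rw [Fintype.card_piFinset] at h1
  simp only [prod_const, card_univ, Fintype.card_fin] at h1
  calc _ ≤ A.card ^ L * (2 ^ S.card) ^ L := Nat.mul_le_mul_right _ h1
    _ = (A.card * 2 ^ S.card) ^ L := by rw [mul_pow]
    _ ≤ _ := Nat.pow_le_pow_left (half_all out hir d m hd2 hm hd S) L

/-- sets explored with `j` inclusions from the candidate list `l` -/
noncomputable def fam {V : Type*} [DecidableEq V] (out : V → Finset V) :
    ℕ → List V → Finset (Finset V)
  | 0, _ => {∅}
  | _ + 1, [] => ∅
  | j + 1, w :: l => fam out (j + 1) l ∪ (fam out j (l ++ (out w).toList)).image (insert w)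
termination_by j l => (j, l.length)

lemma fam_card {V : Type*} [DecidableEq V] (out : V → Finset V) (d : ℕ)
    (hd : ∀ v, (out v).card ≤ d) (j : ℕ) (l : List V) :
    (fam out j l).card ≤ (l.length + d * j).choose j := by
  induction j generalizing l with
  | zero => rw [fam]; simp
  | succ j ih =>
    induction l with
    | nil => rw [fam]; simp
    | cons w l ihl =>
      rw [fam]
      refine (card_union_le _ _).trans ?_
      have h2 : ((fam out j (l ++ (out w).toList)).image (insert w)).card ≤
          (l.length + d * (j + 1)).choose j := by
        refine card_image_le.trans ((ih _).trans ?_)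
        apply Nat.choose_le_choose
        have := hd w
        simp only [List.length_append, length_toList]
        rw [mul_add]; omega
      have h3 : (w :: l).length + d * (j + 1) = (l.length + d * (j + 1)) + 1 := by
        simp; omega
      rw [h3, Nat.choose_succ_succ]
      simp only [Nat.succ_eq_add_one]
      omega

lemma fam_complete {V : Type*} [DecidableEq V] (out : V → Finset V) (R : Finset V) (v : V)
    (hR : ∀ Y : Finset V, v ∈ Y → (∀ a ∈ Y, ∀ b ∈ out a, b ∈ R → b ∈ Y) → R ⊆ Y)
    (hv : v ∈ R) (j : ℕ) (l : List V) (T : Finset V) (hT : T ⊆ R)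
    (h1 : v ∈ T ∨ v ∈ l) (h2 : ∀ a ∈ T, ∀ b ∈ out a, b ∈ R → b ∈ T ∨ b ∈ l)
    (hc : T.card + j ≤ R.card) :
    ∃ A ∈ fam out j l, A ⊆ R ∧ Disjoint T A ∧ A.card = j := by
  induction j generalizing l T with
  | zero => exact ⟨∅, by rw [fam]; simp, by simp, by simp, by simp⟩
  | succ j ih =>
    induction l with
    | nil =>
      have := card_le_card (hR T (by simpa using h1) (by simpa using h2))
      omega
    | cons w l ihl =>
      by_cases hw : w ∈ R ∧ w ∉ T
      · obtain ⟨A, hA, hAR, hd, hcA⟩ := ih (l ++ (out w).toList) (insert w T)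
          (insert_subset hw.1 hT)
          (by
            rcases h1 with h | h
            · simp [h]
            · rcases List.mem_cons.1 h with h | h
              · simp [h]
              · simp [h])
          (by
            intro a ha b hb hbR
            rcases mem_insert.1 ha with h | h
            · subst h; simp [hb]
            · rcases h2 a h b hb hbR with h | h
              · simp [h]
              · rcases List.mem_cons.1 h with h | h
                · simp [h]
                · simp [h])
          (by rw [card_insert_of_notMem hw.2]; omega)
        rw [disjoint_insert_left] at hd
        refine ⟨insert w A, ?_, insert_subset hw.1 hAR, ?_, ?_⟩
        · rw [fam]
          exact mem_union_right _ (mem_image_of_mem _ hA)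
        · rw [disjoint_insert_right]; exact ⟨hw.2, hd.2⟩
        · rw [card_insert_of_notMem hd.1, hcA]
      · have hwT : w ∈ R → w ∈ T := fun h => by
          by_contra h'; exact hw ⟨h, h'⟩
        obtain ⟨A, hA, hr⟩ := ihl
          (by
            rcases h1 with h | h
            · exact Or.inl h
            · rcases List.mem_cons.1 h with h | h
              · subst h; exact Or.inl (hwT hv)
              · exact Or.inr h)
          (by
            intro a ha b hb hbR
            rcases h2 a ha b hb hbR with h | h
            · exact Or.inl h
            · rcases List.mem_cons.1 h with h | h
              · subst h; exact Or.inl (hwT hbR)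
              · exact Or.inr h)
        refine ⟨A, ?_, hr⟩
        rw [fam]
        exact mem_union_left _ hA

lemma bad_witness {V : Type*} [Fintype V] [DecidableEq V] (out : V → Finset V) {L m : ℕ}
    (X : V → Fin L → Fin m) (v : V) (k : ℕ) (hk : 1 ≤ k) (h : k ≤ (failReach out X v).ncard) :
    ∃ A ∈ fam out k [v], A.card = k ∧ ∀ u ∈ A, failed out X u := by
  classical
  have hne : (failReach out X v).Nonempty := by
    apply Set.nonempty_of_ncard_ne_zero; omega
  have hvf : failed out X v := by
    obtain ⟨u, hu, hp⟩ := hne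
    rcases Relation.ReflTransGen.cases_head hp with h | ⟨c, h, _⟩
    · exact h ▸ hu
    · exact h.2.1
  have hfin : (failReach out X v).Finite := Set.toFinite _
  have hmem : ∀ u, u ∈ hfin.toFinset ↔ u ∈ failReach out X v := fun u => hfin.mem_toFinset
  obtain ⟨A, hA, hAR, -, hcA⟩ := fam_complete out hfin.toFinset v
    (by
      intro Y hvY hY u hu
      rw [hmem] at hu
      obtain ⟨-, hp⟩ := hu
      induction hp with
      | refl => exact hvY
      | tail hab hbc ih =>
        exact hY _ ih _ hbc.1 ((hmem _).2 ⟨hbc.2.2, hab.tail hbc⟩))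
    ((hmem _).2 ⟨hvf, Relation.ReflTransGen.refl⟩) k [v] ∅ (by simp) (by simp) (by simp)
    (by rw [Set.ncard_eq_toFinset_card _ hfin] at h; simpa using h)
  exact ⟨A, hA, hcA, fun u hu => ((hmem u).1 (hAR hu)).1⟩

lemma choose_bound (d k : ℕ) (hd : 2 ≤ d) (hk : 1 ≤ k) :
    (1 + d * k).choose k ≤ d ^ (3 * k) := by
  have hd' : (2 : ℝ) ≤ d := by exact_mod_cast hd
  have hd0 : (0 : ℝ) < d := by linarith
  have h1 : ((1 + d * k).choose k : ℝ) * (1 / d) ^ k ≤ (1 / (d : ℝ) + 1) ^ (1 + d * k) := by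
    rw [add_pow]
    have := single_le_sum (f := fun i => (1 / (d : ℝ)) ^ i * 1 ^ (1 + d * k - i) *
      ((1 + d * k).choose i : ℝ)) (s := range (1 + d * k + 1)) (fun i _ => by positivity)
      (show k ∈ range (1 + d * k + 1) by rw [mem_range]; nlinarith)
    simp only [one_pow, mul_one] at this ⊢
    linarith
  have h2 : (1 / (d : ℝ) + 1) ^ (d + 1) ≤ d ^ 2 := by
    rcases Nat.lt_or_ge 2 d with h | h
    · have h3 : (3 : ℝ) ≤ d := by exact_mod_cast h
      have he : (1 / (d : ℝ) + 1) ^ d ≤ 3 := by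
        calc (1 / (d : ℝ) + 1) ^ d ≤ (Real.exp (1 / d)) ^ d :=
              pow_le_pow_left₀ (by positivity) (Real.add_one_le_exp _) _
          _ = Real.exp 1 := by
              rw [← Real.exp_nat_mul]; congr 1; field_simp
          _ ≤ 3 := by have := Real.exp_one_lt_d9; linarith
      have hx : 1 / (d : ℝ) + 1 ≤ 2 := by
        have : 1 / (d : ℝ) ≤ 1 := by rw [div_le_one hd0]; linarith
        linarith
      rw [pow_succ]
      have : 0 < 1 / (d : ℝ) + 1 := by positivity
      nlinarith
    · have : d = 2 := by omega
      subst this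
      norm_num
  have h3 : (1 / (d : ℝ) + 1) ^ (1 + d * k) ≤ (d ^ 2) ^ k := by
    calc _ ≤ (1 / (d : ℝ) + 1) ^ ((d + 1) * k) :=
          pow_le_pow_right₀ (by have : 0 < 1 / (d : ℝ) := by positivity
                                linarith) (by nlinarith)
      _ = ((1 / (d : ℝ) + 1) ^ (d + 1)) ^ k := by rw [pow_mul]
      _ ≤ _ := pow_le_pow_left₀ (by positivity) h2 _
  have h4 : ((1 + d * k).choose k : ℝ) ≤ (d : ℝ) ^ (3 * k) := by
    have h5 := h1.trans h3
    rw [one_div, inv_pow, ← div_eq_mul_inv, div_le_iff₀ (by positivity)] at h5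
    refine h5.trans (le_of_eq ?_)
    rw [← pow_mul, ← pow_add]; congr 1; ring
  exact_mod_cast h4

lemma bad_count {V : Type*} [Fintype V] [DecidableEq V] (out : V → Finset V)
    (hir : ∀ v, v ∉ out v) (d m L : ℕ) (hd2 : 2 ≤ d) (hm : m = 8 * d * Nat.clog 2 d)
    (hL : L = 4 * Nat.clog 2 d)
    (hd : ∀ v, (out v).card ≤ d) (k : ℕ) (hk : 1 ≤ k) (Bad : Finset (V → Fin L → Fin m))
    (hBad : ∀ X ∈ Bad, ∃ v, k ≤ (failReach out X v).ncard) :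
    Bad.card * d ^ k ≤ Fintype.card V * (m ^ Fintype.card V) ^ L := by
  set F : V → Finset (Finset V) := fun v => (fam out k [v]).filter (fun A => A.card = k) with hF
  have hsub : Bad ⊆ univ.biUnion (fun v : V => (F v).biUnion (fun A =>
      univ.filter (fun X : V → Fin L → Fin m => ∀ u ∈ A, failed out X u))) := by
    intro X hX
    obtain ⟨v, hv⟩ := hBad X hX
    obtain ⟨A, hA, hc, hf⟩ := bad_witness out X v k hk hv
    simp only [mem_biUnion, hF, mem_filter, mem_univ, true_and]
    exact ⟨v, A, ⟨hA, hc⟩, hf⟩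
  have hpow : d ^ (4 * k) ≤ (2 ^ k) ^ L := by
    calc d ^ (4 * k) ≤ (2 ^ Nat.clog 2 d) ^ (4 * k) :=
          Nat.pow_le_pow_left (Nat.le_pow_clog (by norm_num) d) _
      _ = (2 ^ k) ^ L := by rw [hL, ← pow_mul, ← pow_mul]; congr 1; ring
  have hmain : Bad.card * d ^ (4 * k) ≤
      Fintype.card V * (d ^ (3 * k) * (m ^ Fintype.card V) ^ L) := by
    calc _ ≤ Bad.card * (2 ^ k) ^ L := Nat.mul_le_mul_left _ hpow
      _ ≤ (∑ v : V, ∑ A ∈ F v, (univ.filter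
            (fun X : V → Fin L → Fin m => ∀ u ∈ A, failed out X u)).card) * (2 ^ k) ^ L := by
          refine Nat.mul_le_mul_right _ ?_
          refine (card_le_card hsub).trans (card_biUnion_le.trans ?_)
          exact sum_le_sum fun v _ => card_biUnion_le
      _ = ∑ v : V, ∑ A ∈ F v, (univ.filter
            (fun X : V → Fin L → Fin m => ∀ u ∈ A, failed out X u)).card * (2 ^ k) ^ L := by
          rw [sum_mul]; simp_rw [sum_mul]
      _ ≤ ∑ v : V, ∑ A ∈ F v, (m ^ Fintype.card V) ^ L := by
          refine sum_le_sum fun v _ => sum_le_sum fun A hA => ?_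
          have hc : A.card = k := (mem_filter.1 hA).2
          have := fail_count out hir d m L hd2 hm hd A
          rwa [hc] at this
      _ ≤ ∑ v : V, d ^ (3 * k) * (m ^ Fintype.card V) ^ L := by
          refine sum_le_sum fun v _ => ?_
          rw [sum_const, smul_eq_mul]
          refine Nat.mul_le_mul_right _ ?_
          refine (card_filter_le _ _).trans ((fam_card out d hd k [v]).trans ?_)
          exact choose_bound d k hd2 hk
      _ = _ := by simp
  have h4 : d ^ (4 * k) = d ^ (3 * k) * d ^ k := by rw [← pow_add]; congr 1; ring
  rw [h4] at hmain
  have h5 : d ^ (3 * k) * (Bad.card * d ^ k) ≤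
      d ^ (3 * k) * (Fintype.card V * (m ^ Fintype.card V) ^ L) := by
    calc _ = Bad.card * (d ^ (3 * k) * d ^ k) := by ring
      _ ≤ _ := hmain
      _ = _ := by ring
  exact Nat.le_of_mul_le_mul_left h5 (by positivity)

lemma pi_meas {V : Type*} [Fintype V] (L m : ℕ) [NeZero m] (B : Finset (V → Fin L → Fin m)) :
    Measure.pi (fun _ : V => (PMF.uniformOfFintype (Fin L → Fin m)).toMeasure) (B : Set _)
      = (B.card : ℝ≥0∞) * (((m ^ Fintype.card V) ^ L : ℕ) : ℝ≥0∞)⁻¹ := by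
  classical
  rw [← sum_measure_singleton]
  have : ∀ X : V → Fin L → Fin m,
      Measure.pi (fun _ : V => (PMF.uniformOfFintype (Fin L → Fin m)).toMeasure) {X}
      = (((m ^ Fintype.card V) ^ L : ℕ) : ℝ≥0∞)⁻¹ := by
    intro X
    rw [Measure.pi_singleton]
    simp only [PMF.toMeasure_apply_singleton _ _ (MeasurableSet.singleton _),
      PMF.uniformOfFintype_apply, prod_const, card_univ, Fintype.card_fun, Fintype.card_fin]
    rw [← ENNReal.inv_pow]
    congr 1
    push_cast
    rw [← pow_mul, ← pow_mul, mul_comm]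
  simp [this]

end helpers

theorem stmt9 {V : Type*} [Fintype V] [DecidableEq V] (G : SimpleGraph V)
    (n : ℕ) (hn : Fintype.card V = n) (hn2 : 2 ≤ n)
    (d : ℕ) (hd : 2 ≤ d)
    -- an orientation of `G` with at most `d` out-neighbours per vertex:
    (out : V → Finset V)
    (hout_adj : ∀ u w, w ∈ out u → G.Adj u w)
    (hout_cov : ∀ u w, G.Adj u w → w ∈ out u ∨ u ∈ out w)
    (hout_card : ∀ u, (out u).card ≤ d)
    (c : ℝ) (hc : 1 ≤ c)
    (L m : ℕ) (hL : L = 4 * Nat.clog 2 d) (hm : m = 8 * d * Nat.clog 2 d) [NeZero m] :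
    (1 : ℝ≥0∞) - (n : ℝ≥0∞) ^ (-c) ≤
      Measure.pi (fun _ : V => (PMF.uniformOfFintype (Fin L → Fin m)).toMeasure)
        {X : V → Fin L → Fin m | ∀ v : V,
          ((failReach out X v).ncard : ℝ) ≤ (c + 1) * Real.log n / Real.log d} := by
  classical
  set μ := Measure.pi (fun _ : V => (PMF.uniformOfFintype (Fin L → Fin m)).toMeasure) with hμ
  set good := {X : V → Fin L → Fin m | ∀ v : V,
          ((failReach out X v).ncard : ℝ) ≤ (c + 1) * Real.log n / Real.log d} with hgood
  have hd' : (2 : ℝ) ≤ d := by exact_mod_cast hd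
  have hn' : (2 : ℝ) ≤ n := by exact_mod_cast hn2
  have hlogd : 0 < Real.log d := Real.log_pos (by linarith)
  have hlogn : 0 < Real.log n := Real.log_pos (by linarith)
  set b := (c + 1) * Real.log n / Real.log d with hb
  have hb0 : 0 ≤ b := by positivity
  set k := ⌊b⌋₊ + 1 with hk
  have hbk : b < k := by rw [hk]; push_cast; exact Nat.lt_floor_add_one b
  have hbad : ∀ X ∈ goodᶜ.toFinset, ∃ v, k ≤ (failReach out X v).ncard := by
    intro X hX
    rw [Set.mem_toFinset] at hX
    simp only [hgood, Set.mem_compl_iff, Set.mem_ofPred_eq, not_forall, not_le] at hX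
    obtain ⟨v, hv⟩ := hX
    exact ⟨v, (Nat.floor_lt hb0).2 hv⟩
  have hcount := bad_count out (fun v hv => G.loopless.irrefl v (hout_adj v v hv)) d m L hd hm hL
    hout_card k (by omega) _ hbad
  have hm0 : 0 < m := Nat.pos_of_ne_zero (NeZero.ne m)
  rw [hn] at hcount
  have hdk : (n : ℝ) ^ (c + 1) ≤ (d : ℝ) ^ k := by
    rw [← Real.rpow_natCast, Real.rpow_def_of_pos (by linarith), Real.rpow_def_of_pos (by linarith)]
    apply Real.exp_le_exp.2
    rw [hb, div_lt_iff₀ hlogd] at hbk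
    linarith
  have hM : (0 : ℝ) < ((m ^ n) ^ L : ℕ) := by positivity
  have hreal : ((goodᶜ.toFinset.card : ℕ) : ℝ) / (((m ^ n) ^ L : ℕ) : ℝ) ≤ (n : ℝ) ^ (-c) := by
    have h1 : ((goodᶜ.toFinset.card : ℕ) : ℝ) * (d : ℝ) ^ k ≤ n * (((m ^ n) ^ L : ℕ) : ℝ) := by
      exact_mod_cast hcount
    have h2 : ((goodᶜ.toFinset.card : ℕ) : ℝ) * (n : ℝ) ^ (c + 1) ≤
        n * (((m ^ n) ^ L : ℕ) : ℝ) :=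
      (mul_le_mul_of_nonneg_left hdk (by positivity)).trans h1
    rw [Real.rpow_add (by linarith), Real.rpow_one] at h2
    rw [div_le_iff₀ hM, Real.rpow_neg (by linarith), inv_mul_eq_div, le_div_iff₀ (by positivity)]
    have hn0 : (0 : ℝ) < n := by linarith
    refine le_of_mul_le_mul_left ?_ hn0
    linarith
  have hmeas : μ goodᶜ ≤ (n : ℝ≥0∞) ^ (-c) := by
    have h1 := pi_meas L m goodᶜ.toFinset
    rw [Set.coe_toFinset, hn] at h1
    rw [hμ, h1, ← div_eq_mul_inv]
    have h2 := ENNReal.ofReal_le_ofReal hreal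
    rw [ENNReal.ofReal_div_of_pos hM, ENNReal.ofReal_natCast, ENNReal.ofReal_natCast,
      ← ENNReal.ofReal_rpow_of_pos (by linarith), ENNReal.ofReal_natCast] at h2
    exact h2
  rw [tsub_le_iff_right]
  calc (1 : ℝ≥0∞) = μ Set.univ := by rw [hμ]; exact measure_univ.symm
    _ = μ (good ∪ goodᶜ) := by rw [Set.union_compl_self]
    _ ≤ μ good + μ goodᶜ := measure_union_le _ _
    _ ≤ _ := by gcongr
end

section
/- Let H be a directed graph on a finite vertex set V with |V| = n in which every vertex has out-degree at most D, and let ≤ be a linear order on V. Then there exist t = ⌈n/(D+1)⌉ distinct vertices v_1 < v_2 < ⋯ < v_t (increasing with respect to ≤) such that for all i < j there is no edge v_i → v_j in H. -/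
theorem stmt11_aux {V : Type*} [LinearOrder V] (D : ℕ)
    (out : V → Finset V) (hout : ∀ u, (out u).card ≤ D) (S : Finset V) :
    ∃ T ⊆ S, S.card ≤ T.card * (D + 1) ∧ ∀ a ∈ T, ∀ b ∈ T, a < b → b ∉ out a := by
  induction S using Finset.strongInduction with
  | H S ih =>
    rcases S.eq_empty_or_nonempty with rfl | hS
    · exact ⟨∅, by simp⟩
    · set m := S.min' hS with hm
      have hmS : m ∈ S := S.min'_mem hS
      have hlt : S \ insert m (out m) ⊂ S := by
        refine Finset.ssubset_iff_subset_ne.2 ⟨Finset.sdiff_subset, fun h => ?_⟩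
        rw [← h] at hmS
        simp at hmS
      obtain ⟨T, hT, hc, hi⟩ := ih _ hlt
      have hmT : m ∉ T := fun h => by simpa using hT h
      refine ⟨insert m T, ?_, ?_, ?_⟩
      · exact Finset.insert_subset hmS (hT.trans Finset.sdiff_subset)
      · rw [Finset.card_insert_of_notMem hmT]
        have h1 := Finset.le_card_sdiff (insert m (out m)) S
        have h2 := Finset.card_insert_le m (out m)
        have h3 := hout m
        rw [add_mul]
        omega
      · intro a ha b hb hab
        rw [Finset.mem_insert] at ha hb
        have hbT : b ∈ T := by
          rcases hb with rfl | hb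
          · rcases ha with rfl | ha
            · exact absurd hab (lt_irrefl _)
            · have := S.min'_le a (Finset.sdiff_subset (hT ha))
              exact absurd hab (not_lt.2 this)
          · exact hb
        rcases ha with rfl | ha
        · have := hT hbT
          simp only [Finset.mem_sdiff, Finset.mem_insert, not_or] at this
          exact this.2.2
        · exact hi a ha b hbT hab

theorem stmt11 {V : Type*} [Fintype V] [DecidableEq V] [LinearOrder V]
    (n D : ℕ) (hn : Fintype.card V = n)
    -- a directed graph `H` on `V` with out-degree at most `D`:
    (out : V → Finset V) (hout : ∀ u, (out u).card ≤ D) :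
    -- there are `t = ⌈n/(D+1)⌉` vertices, increasing in the order, with no
    -- edge from an earlier one to a later one:
    ∃ v : Fin ((n + D) / (D + 1)) → V, StrictMono v ∧
      ∀ i j, i < j → v j ∉ out (v i) := by
  obtain ⟨T, -, hc, hi⟩ := stmt11_aux D out hout Finset.univ
  rw [Finset.card_univ, hn] at hc
  have ht : (n + D) / (D + 1) ≤ T.card := by
    rw [← Nat.lt_succ_iff, Nat.div_lt_iff_lt_mul (Nat.succ_pos D), Nat.succ_mul, Nat.succ_eq_add_one]
    omega
  let f := T.orderEmbOfCardLe ht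
  refine ⟨f, f.strictMono, fun i j hij => ?_⟩
  exact hi _ (T.orderEmbOfCardLe_mem ht i) _ (T.orderEmbOfCardLe_mem ht j) (f.strictMono hij)
end
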